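/- arXiv:2303.17675 — 2 statements merged into one kernel-verified Lean document; each statement's English description precedes it below -/
import Mathlib

section
/- Willems' Fundamental Lemma: Let A ∈ ℝ^{n×n} and B ∈ ℝ^{n×m}, and suppose the pair (A,B) is controllable, i.e., the controllability matrix [B, AB, ..., A^{n−1}B] ∈ ℝ^{n×nm} has rank n. Let u_0,...,u_{T−1} ∈ ℝ^m and x_0,...,x_T ∈ ℝ^n be data satisfying x_{k+1} = A x_k + B u_k for all k = 0,...,T−1. If the input signal is persistently exciting of order n+1, i.e., the block-Hankel matrix U_{0,n+1,T−n} ∈ ℝ^{m(n+1)×(T−n)} whose (i,j) block entry is u_{i+j} (0 ≤ i ≤ n, 0 ≤ j ≤ T−n−1) has rank m(n+1), then the stacked data matrix W₀ = [U_{0,T}; X_{0,T}] ∈ ℝ^{(m+n)×T}, whose k-th column is (u_k; x_k), has rank n + m. -/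
open Matrix

/-- A real matrix has full row rank iff its left kernel is trivial. -/
lemma Matrix.rank_eq_card_iff_vecMul_eq_zero {ι κ : Type*} [Fintype ι] [Fintype κ]
    (M : Matrix ι κ ℝ) :
    M.rank = Fintype.card ι ↔ ∀ v : ι → ℝ, v ᵥ* M = 0 → v = 0 := by
  have h : (∀ v : ι → ℝ, v ᵥ* M = 0 → v = 0) ↔ LinearIndependent ℝ M.row := by
    rw [← Matrix.vecMul_injective_iff]
    exact (injective_iff_map_eq_zero M.vecMulLinear).symm
  rw [h, linearIndependent_iff_card_eq_finrank_span, Matrix.rank_eq_finrank_span_row, eq_comm]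
  rfl

/-- Variation of constants for the discrete-time system `x (k + 1) = A x k + B u k`. -/
lemma state_add_eq {ι κ : Type*} [Fintype ι] [DecidableEq ι] [Fintype κ] {T : ℕ}
    {A : Matrix ι ι ℝ} {B : Matrix ι κ ℝ} {u : ℕ → κ → ℝ} {x : ℕ → ι → ℝ}
    (hdyn : ∀ k < T, x (k + 1) = A *ᵥ x k + B *ᵥ u k) (k j : ℕ) (hkj : k + j ≤ T) :
    x (k + j) = A ^ j *ᵥ x k +
      ∑ i ∈ Finset.range j, (A ^ (j - 1 - i) * B) *ᵥ u (k + i) := by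
  induction j with
  | zero => simp
  | succ j ih =>
    rw [← add_assoc, hdyn (k + j) (by omega), ih (by omega), Finset.sum_range_succ,
      Matrix.mulVec_add, Matrix.mulVec_mulVec, ← pow_succ', Matrix.mulVec_sum, add_assoc]
    congr 2
    · refine Finset.sum_congr rfl fun i hi => ?_
      have hij := Finset.mem_range.mp hi
      rw [Matrix.mulVec_mulVec, ← Matrix.mul_assoc, ← pow_succ',
        show j - 1 - i + 1 = j + 1 - 1 - i by omega]
    · simp

/-- If every `η ⬝ᵥ u k + ξ ⬝ᵥ x k` vanishes, eliminating the state by a polynomial `∑ j, a j X ^ j`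
annihilating `A` yields a linear relation between windows of the input. -/
lemma sum_input_eq_zero {ι κ : Type*} [Fintype ι] [DecidableEq ι] [Fintype κ] {T n : ℕ}
    {A : Matrix ι ι ℝ} {B : Matrix ι κ ℝ} {u : ℕ → κ → ℝ} {x : ℕ → ι → ℝ}
    (hdyn : ∀ k < T, x (k + 1) = A *ᵥ x k + B *ᵥ u k) {a : ℕ → ℝ}
    (ha : ∑ j ∈ Finset.range (n + 1), a j • A ^ j = 0) {η : κ → ℝ} {ξ : ι → ℝ}
    (h : ∀ k < T, η ⬝ᵥ u k + ξ ⬝ᵥ x k = 0) {k : ℕ} (hk : k < T - n) :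
    ∑ i ∈ Finset.range (n + 1), (a i • η + ∑ j ∈ Finset.range (n + 1),
      if i < j then a j • (ξ ᵥ* (A ^ (j - 1 - i) * B)) else 0) ⬝ᵥ u (k + i) = 0 := by
  have hstate : ∑ j ∈ Finset.range (n + 1), a j * (ξ ⬝ᵥ A ^ j *ᵥ x k) = 0 := by
    have := congrArg (fun M => ξ ⬝ᵥ M *ᵥ x k) ha
    simpa [Matrix.sum_mulVec, dotProduct_sum, Matrix.smul_mulVec] using this
  have hrel : ∑ j ∈ Finset.range (n + 1), a j * (η ⬝ᵥ u (k + j) + ξ ⬝ᵥ x (k + j)) = 0 := by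
    refine Finset.sum_eq_zero fun j hj => ?_
    have := Finset.mem_range.mp hj
    rw [h (k + j) (by omega), mul_zero]
  have hforced : ∀ j ∈ Finset.range (n + 1), ξ ⬝ᵥ x (k + j) = ξ ⬝ᵥ A ^ j *ᵥ x k +
      ∑ i ∈ Finset.range (n + 1),
        if i < j then (ξ ᵥ* (A ^ (j - 1 - i) * B)) ⬝ᵥ u (k + i) else 0 := by
    intro j hj
    have := Finset.mem_range.mp hj
    rw [state_add_eq hdyn k j (by omega), dotProduct_add, dotProduct_sum, ← Finset.sum_filter]
    congr 1
    refine Finset.sum_congr ?_ fun i _ => dotProduct_mulVec _ _ _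
    ext i
    simp only [Finset.mem_range, Finset.mem_filter]
    omega
  rw [← hrel]
  simp only [add_dotProduct, Finset.sum_add_distrib, mul_add, smul_dotProduct, smul_eq_mul,
    sum_dotProduct]
  congr 1
  rw [Finset.sum_comm, eq_comm, ← sub_eq_zero, ← Finset.sum_sub_distrib, ← hstate]
  refine Finset.sum_congr rfl fun j hj => ?_
  rw [hforced j hj, mul_add, add_sub_assoc, add_eq_left, sub_eq_zero]
  rw [Finset.mul_sum]
  refine Finset.sum_congr rfl fun i _ => ?_
  split_ifs <;> simp

/-- Willems' Fundamental Lemma: if `(A, B)` is controllable and the input signal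
`u` is persistently exciting of order `n + 1`, then the stacked input/state data
matrix `W₀ = [U_{0,T}; X_{0,T}]` has full row rank `n + m`. -/
theorem willems_fundamental_lemma (n m T : ℕ)
    (A : Matrix (Fin n) (Fin n) ℝ) (B : Matrix (Fin n) (Fin m) ℝ)
    (hctrb : (Matrix.of fun (i : Fin n) (kj : Fin n × Fin m) =>
        (A ^ (kj.1 : ℕ) * B) i kj.2).rank = n)
    (u : ℕ → Fin m → ℝ) (x : ℕ → Fin n → ℝ)
    (hdyn : ∀ k < T, x (k + 1) = A.mulVec (x k) + B.mulVec (u k))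
    (hPE : (Matrix.of fun (ip : Fin (n + 1) × Fin m) (j : Fin (T - n)) =>
        u ((ip.1 : ℕ) + (j : ℕ)) ip.2).rank = m * (n + 1))
    (W0 : Matrix (Fin m ⊕ Fin n) (Fin T) ℝ)
    (hW0u : ∀ (p : Fin m) (k : Fin T), W0 (Sum.inl p) k = u k p)
    (hW0x : ∀ (i : Fin n) (k : Fin T), W0 (Sum.inr i) k = x k i) :
    W0.rank = n + m := by
  have hctrb' := (Matrix.rank_eq_card_iff_vecMul_eq_zero _).mp (hctrb.trans (by simp))
  have hPE' := (Matrix.rank_eq_card_iff_vecMul_eq_zero _).mp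
    (hPE.trans (by simp [mul_comm]))
  refine ((Matrix.rank_eq_card_iff_vecMul_eq_zero W0).mpr fun v hv => ?_).trans
    (by simp [add_comm])
  set η : Fin m → ℝ := fun p => v (Sum.inl p)
  set ξ : Fin n → ℝ := fun i => v (Sum.inr i)
  have hannih : ∀ k < T, η ⬝ᵥ u k + ξ ⬝ᵥ x k = 0 := by
    intro k hk
    have := congrFun hv ⟨k, hk⟩
    simpa [Matrix.vecMul, dotProduct, Fintype.sum_sum_type, hW0u, hW0x] using this
  set a : ℕ → ℝ := A.charpoly.coeff
  have hdeg : A.charpoly.natDegree = n := by simp [Matrix.charpoly_natDegree_eq_dim]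
  have han : a n = 1 := by
    have := A.charpoly_monic.coeff_natDegree
    rwa [hdeg] at this
  have ha : ∑ j ∈ Finset.range (n + 1), a j • A ^ j = 0 := by
    have := A.aeval_self_charpoly
    rwa [Polynomial.aeval_eq_sum_range, hdeg] at this
  set g : ℕ → Fin m → ℝ := fun i => a i • η + ∑ j ∈ Finset.range (n + 1),
    if i < j then a j • (ξ ᵥ* (A ^ (j - 1 - i) * B)) else 0 with hg_def
  have hg : ∀ i < n + 1, g i = 0 := by
    have hw := hPE' (fun ip => g ip.1 ip.2) <| by
      ext k
      have := sum_input_eq_zero hdyn ha hannih k.2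
      rw [← Fin.sum_univ_eq_sum_range (fun i => g i ⬝ᵥ u (k + i)) (n + 1)] at this
      simpa [Matrix.vecMul, dotProduct, Fintype.sum_prod_type, add_comm] using this
    intro i hi
    ext p
    exact congrFun hw (⟨i, hi⟩, p)
  have hη : η = 0 := by
    have h := hg n n.lt_succ_self
    simp only [hg_def, han, one_smul] at h
    rwa [Finset.sum_eq_zero, add_zero] at h
    intro j hj
    have := Finset.mem_range.mp hj
    rw [if_neg (by omega)]
  have hmarkov : ∀ d < n, ξ ᵥ* (A ^ d * B) = 0 := by
    intro d
    induction d using Nat.strong_induction_on with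
    | _ d ih =>
      intro hd
      have h := hg (n - 1 - d) (by omega)
      simp only [hg_def, hη, smul_zero, zero_add] at h
      rw [Finset.sum_eq_single n] at h
      · rwa [if_pos (by omega), han, one_smul, show n - 1 - (n - 1 - d) = d by omega] at h
      · intro j hj hjn
        have := Finset.mem_range.mp hj
        split_ifs with hlt
        · rw [ih _ (by omega) (by omega), smul_zero]
        · rfl
      · simp
  have hξ : ξ = 0 := by
    refine hctrb' ξ ?_
    ext kj
    exact congrFun (hmarkov kj.1 kj.1.2) kj.2
  ext (p | i)
  · exact congrFun hη p
  · exact congrFun hξ i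
end

section
/- Data-based representation of the mean dynamics (Theorem 1): Let A ∈ ℝ^{n×n}, B ∈ ℝ^{n×m}, and let u_0,...,u_{T−1} ∈ ℝ^m, x_0,...,x_T ∈ ℝ^n satisfy x_{k+1} = A x_k + B u_k for all k = 0,...,T−1. Assume W₀ W₀ᵀ ∈ ℝ^{(m+n)×(m+n)} is invertible. Then for every μ ∈ ℝ^n and v ∈ ℝ^m, A μ + B v = X_{1,T} W₀ᵀ (W₀ W₀ᵀ)⁻¹ [v; μ], where [v; μ] ∈ ℝ^{m+n} is the vector obtained by stacking v on top of μ. -/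
open Matrix

/-- Data-based representation of the mean dynamics (Theorem 1): for data
consistent with `x_{k+1} = A x_k + B u_k`, and `W₀ W₀ᵀ` invertible, one has
`A μ + B v = X_{1,T} W₀ᵀ (W₀ W₀ᵀ)⁻¹ [v; μ]` for all `μ, v`. -/
theorem data_based_mean_dynamics (n m T : ℕ)
    (A : Matrix (Fin n) (Fin n) ℝ) (B : Matrix (Fin n) (Fin m) ℝ)
    (u : ℕ → Fin m → ℝ) (x : ℕ → Fin n → ℝ)
    (hdyn : ∀ k < T, x (k + 1) = A.mulVec (x k) + B.mulVec (u k))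
    (W0 : Matrix (Fin m ⊕ Fin n) (Fin T) ℝ)
    (hW0u : ∀ (p : Fin m) (k : Fin T), W0 (Sum.inl p) k = u k p)
    (hW0x : ∀ (i : Fin n) (k : Fin T), W0 (Sum.inr i) k = x k i)
    (X1 : Matrix (Fin n) (Fin T) ℝ)
    (hX1 : ∀ (i : Fin n) (k : Fin T), X1 i k = x ((k : ℕ) + 1) i)
    (hinv : IsUnit (W0 * W0ᵀ)) :
    ∀ (μ : Fin n → ℝ) (v : Fin m → ℝ),
      A.mulVec μ + B.mulVec v =
        (X1 * W0ᵀ * (W0 * W0ᵀ)⁻¹).mulVec (Sum.elim v μ) := by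
  have hX : X1 = fromCols B A * W0 := by
    ext i k
    simp [hX1, hdyn k k.isLt, mul_apply, mulVec, dotProduct, hW0u, hW0x, add_comm]
  intro μ v
  rw [hX, Matrix.mul_assoc (fromCols B A),
    mul_nonsing_inv_cancel_right _ _ ((isUnit_iff_isUnit_det _).mp hinv),
    fromCols_mulVec_sumElim, add_comm]
end
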